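/- Assume 0 < ε < 1/2, x₀ ∈ co({v₁, v₂, v₃, v₄}), and u₀ ∈ E₁ satisfies ‖u₀ − x₀‖ < ε. Then there exists v₀ ∈ E₁ with ‖v₀ − u₀‖ < 3ε, together with a set A ⊆ {1,…,8} and nonnegative coefficients (β_i)_{i∈A} with ∑_{i∈A} β_i = 1 and (γ_i)_{i∈A, i≤4} with ∑_{i∈A, i≤4} γ_i = 1, such that u₀ = ∑_{i∈A} β_i v_i, v₀ = ∑_{i∈A, i≤4} γ_i v_i, and γ_i > 0 implies β_i > 0 for every i. -/

import Mathlib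

/-- The face `E₁ = {x ∈ ℓ∞⁴ : x(1) = 1 = ‖x‖}` of the unit ball of `ℓ∞⁴`
(here `Fin 4 → ℝ` carries the sup norm, i.e. it is `ℓ∞⁴`). -/
def E1 : Set (Fin 4 → ℝ) := {x | x 0 = 1 ∧ ‖x‖ = 1}

/-- The eight vertices `v₁, …, v₈` of `E₁` (0-indexed). -/
def v : Fin 8 → (Fin 4 → ℝ) :=
  ![![1, 1, 1, 1], ![1, -1, 1, 1], ![1, -1, -1, 1], ![1, -1, -1, -1],
    ![1, 1, -1, 1], ![1, 1, -1, -1], ![1, 1, 1, -1], ![1, -1, 1, -1]]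

lemma v_apply_zero (i : Fin 8) : v i 0 = 1 := by
  fin_cases i <;> rfl

lemma norm_v_le (i : Fin 8) : ‖v i‖ ≤ 1 := by
  rw [pi_norm_le_iff_of_nonneg zero_le_one]
  intro k
  fin_cases i <;> fin_cases k <;> simp [v]

lemma norm_sum_smul_v_le (s : Finset (Fin 8)) (w : Fin 8 → ℝ) (hw : ∀ i ∈ s, 0 ≤ w i) :
    ‖∑ i ∈ s, w i • v i‖ ≤ ∑ i ∈ s, w i := by
  refine norm_sum_le_of_le s fun i hi => ?_
  rw [norm_smul, Real.norm_of_nonneg (hw i hi)]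
  exact mul_le_of_le_one_right (hw i hi) (norm_v_le i)

lemma sum_smul_v_mem_E1 (s : Finset (Fin 8)) (w : Fin 8 → ℝ) (hw : ∀ i ∈ s, 0 ≤ w i)
    (hsum : ∑ i ∈ s, w i = 1) : ∑ i ∈ s, w i • v i ∈ E1 := by
  have h0 : (∑ i ∈ s, w i • v i) 0 = 1 := by simp [v_apply_zero, hsum]
  refine ⟨h0, le_antisymm ((norm_sum_smul_v_le s w hw).trans hsum.le) ?_⟩
  simpa only [h0, norm_one] using norm_le_pi_norm (∑ i ∈ s, w i • v i) 0

/-- Discarding the vertices outside `s` from a convex combination and renormalizing moves the point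
by at most twice the discarded mass. -/
lemma norm_renormalize_sub_le (s : Finset (Fin 8)) (w : Fin 8 → ℝ) (hw : ∀ i, 0 ≤ w i)
    (hsum : ∑ i, w i = 1) (hs : 0 < ∑ i ∈ s, w i) :
    ‖∑ i ∈ s, (w i / ∑ j ∈ s, w j) • v i - ∑ i, w i • v i‖ ≤ 2 * ∑ i ∈ sᶜ, w i := by
  have hsplit := Finset.sum_add_sum_compl s w
  set m := ∑ i ∈ s, w i
  set n := ∑ i ∈ sᶜ, w i
  have hn : 0 ≤ n := Finset.sum_nonneg fun i _ => hw i
  set y := ∑ i ∈ s, (w i / m) • v i with hy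
  have hy1 : ‖y‖ ≤ 1 := by
    refine (norm_sum_smul_v_le s _ fun i _ => div_nonneg (hw i) hs.le).trans ?_
    rw [← Finset.sum_div, div_self hs.ne']
  have hmy : m • y = ∑ i ∈ s, w i • v i := by
    rw [hy, Finset.smul_sum]
    exact Finset.sum_congr rfl fun i _ => by rw [smul_smul, mul_div_cancel₀ _ hs.ne']
  have hdiff : y - ∑ i, w i • v i = n • y - ∑ i ∈ sᶜ, w i • v i := by
    rw [← Finset.sum_add_sum_compl s, ← hmy, show n = 1 - m by linarith]
    module
  calc ‖y - ∑ i, w i • v i‖ ≤ ‖n • y‖ + ‖∑ i ∈ sᶜ, w i • v i‖ := hdiff ▸ norm_sub_le _ _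
    _ ≤ n * 1 + n := by
        refine add_le_add ?_ (norm_sum_smul_v_le _ _ fun i _ => hw i)
        rw [norm_smul, Real.norm_of_nonneg hn]
        exact mul_le_mul_of_nonneg_left hy1 hn
    _ = 2 * n := by ring

lemma le_of_mem_convexHull_v {x : Fin 4 → ℝ} (hx : x ∈ convexHull ℝ {v 0, v 1, v 2, v 3}) :
    x 1 ≤ x 2 ∧ x 2 ≤ x 3 := by
  refine convexHull_min (t := {x : Fin 4 → ℝ | x 1 ≤ x 2 ∧ x 2 ≤ x 3}) ?_ ?_ hx
  · rintro _ (rfl | rfl | rfl | rfl) <;> simp [v]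
  · rintro a ⟨ha, ha'⟩ b ⟨hb, hb'⟩ s t hs ht -
    simp only [Set.mem_ofPred_eq, Pi.add_apply, Pi.smul_apply, smul_eq_mul]
    constructor <;> gcongr

/-- Barycentric coordinates in the Kuhn triangulation of the cube `E₁`: if the coordinates of `u`
violate the order `u 1 ≤ u 2 ≤ u 3` by less than `2 * ε`, the vertices outside `v 0, …, v 3` carry
mass less than `ε`. -/
lemma exists_weights {u : Fin 4 → ℝ} {ε : ℝ} (hε : 0 < ε) (h0 : u 0 = 1)
    (hlo : ∀ k, -1 ≤ u k) (hhi : ∀ k, u k ≤ 1)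
    (h12 : u 1 - u 2 < 2 * ε) (h23 : u 2 - u 3 < 2 * ε) (h13 : u 1 - u 3 < 2 * ε) :
    ∃ w : Fin 8 → ℝ, (∀ i, 0 ≤ w i) ∧ ∑ i, w i = 1 ∧ u = ∑ i, w i • v i ∧
      w 4 + w 5 + w 6 + w 7 < ε := by
  suffices h : ∃ a b c d e f g h : ℝ,
      (0 ≤ a ∧ 0 ≤ b ∧ 0 ≤ c ∧ 0 ≤ d ∧ 0 ≤ e ∧ 0 ≤ f ∧ 0 ≤ g ∧ 0 ≤ h) ∧
      a + b + c + d + e + f + g + h = 1 ∧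
      u 1 = a - b - c - d + e + f + g - h ∧
      u 2 = a + b - c - d - e - f + g + h ∧
      u 3 = a + b + c - d + e - f - g - h ∧
      e + f + g + h < ε by
    obtain ⟨a, b, c, d, e, f, g, h, ⟨ha, hb, hc, hd, he, hf, hg, hh⟩, hs, h1, h2, h3, hlt⟩ := h
    refine ⟨![a, b, c, d, e, f, g, h], ?_, ?_, ?_, ?_⟩
    · intro i
      fin_cases i <;> assumption
    · simpa [Fin.sum_univ_eight] using hs
    · ext k
      fin_cases k <;> simp [Fin.sum_univ_eight, v] <;> linarith
    · simpa using hlt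
  have l1 := hlo 1
  have l2 := hlo 2
  have l3 := hlo 3
  have m1 := hhi 1
  have m2 := hhi 2
  have m3 := hhi 3
  rcases le_total (u 1) (u 2) with h | h <;> rcases le_total (u 2) (u 3) with h' | h' <;>
    rcases le_total (u 1) (u 3) with h'' | h''
  · refine ⟨(1 + u 1) / 2, (u 2 - u 1) / 2, (u 3 - u 2) / 2, (1 - u 3) / 2, 0, 0, 0, 0,
      ⟨?_, ?_, ?_, ?_, ?_, ?_, ?_, ?_⟩, ?_, ?_, ?_, ?_, ?_⟩ <;> linarith
  · refine ⟨(1 + u 1) / 2, (u 2 - u 1) / 2, (u 3 - u 2) / 2, (1 - u 3) / 2, 0, 0, 0, 0,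
      ⟨?_, ?_, ?_, ?_, ?_, ?_, ?_, ?_⟩, ?_, ?_, ?_, ?_, ?_⟩ <;> linarith
  · refine ⟨(1 + u 1) / 2, (u 3 - u 1) / 2, 0, (1 - u 2) / 2, 0, 0, 0, (u 2 - u 3) / 2,
      ⟨?_, ?_, ?_, ?_, ?_, ?_, ?_, ?_⟩, ?_, ?_, ?_, ?_, ?_⟩ <;> linarith
  · refine ⟨(1 + u 3) / 2, 0, 0, (1 - u 2) / 2, 0, 0, (u 1 - u 3) / 2, (u 2 - u 1) / 2,
      ⟨?_, ?_, ?_, ?_, ?_, ?_, ?_, ?_⟩, ?_, ?_, ?_, ?_, ?_⟩ <;> linarith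
  · refine ⟨(1 + u 2) / 2, 0, (u 3 - u 1) / 2, (1 - u 3) / 2, (u 1 - u 2) / 2, 0, 0, 0,
      ⟨?_, ?_, ?_, ?_, ?_, ?_, ?_, ?_⟩, ?_, ?_, ?_, ?_, ?_⟩ <;> linarith
  · refine ⟨(1 + u 2) / 2, 0, 0, (1 - u 1) / 2, (u 3 - u 2) / 2, (u 1 - u 3) / 2, 0, 0,
      ⟨?_, ?_, ?_, ?_, ?_, ?_, ?_, ?_⟩, ?_, ?_, ?_, ?_, ?_⟩ <;> linarith
  · refine ⟨(1 + u 3) / 2, 0, 0, (1 - u 1) / 2, 0, (u 1 - u 2) / 2, (u 2 - u 3) / 2, 0,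
      ⟨?_, ?_, ?_, ?_, ?_, ?_, ?_, ?_⟩, ?_, ?_, ?_, ?_, ?_⟩ <;> linarith
  · refine ⟨(1 + u 3) / 2, 0, 0, (1 - u 1) / 2, 0, (u 1 - u 2) / 2, (u 2 - u 3) / 2, 0,
      ⟨?_, ?_, ?_, ?_, ?_, ?_, ?_, ?_⟩, ?_, ?_, ?_, ?_, ?_⟩ <;> linarith

/-- If `x₀ ∈ co{v₁,v₂,v₃,v₄}` and `u₀ ∈ E₁` with `‖u₀ − x₀‖ < ε`, then there exist
`v₀ ∈ E₁` with `‖v₀ − u₀‖ < 3ε`, a set `A ⊆ {1,…,8}` and convex coefficients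
`(β_i)_{i ∈ A}`, `(γ_i)_{i ∈ A, i ≤ 4}` with `u₀ = ∑_{i∈A} β_i v_i`,
`v₀ = ∑_{i∈A, i≤4} γ_i v_i` and `γ_i > 0 → β_i > 0`. -/
theorem stmt10 (ε : ℝ) (hε0 : 0 < ε) (hε1 : ε < 1 / 2)
    (x₀ : Fin 4 → ℝ) (hx₀ : x₀ ∈ convexHull ℝ {v 0, v 1, v 2, v 3})
    (u₀ : Fin 4 → ℝ) (hu₀ : u₀ ∈ E1) (hclose : ‖u₀ - x₀‖ < ε) :
    ∃ v₀ ∈ E1, ‖v₀ - u₀‖ < 3 * ε ∧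
      ∃ A : Finset (Fin 8), ∃ β c : Fin 8 → ℝ,
        (∀ i ∈ A, 0 ≤ β i) ∧ (∑ i ∈ A, β i) = 1 ∧
        u₀ = ∑ i ∈ A, β i • v i ∧
        (∀ i ∈ A.filter (fun i : Fin 8 => (i : ℕ) < 4), 0 ≤ c i) ∧
        (∑ i ∈ A.filter (fun i : Fin 8 => (i : ℕ) < 4), c i) = 1 ∧
        v₀ = (∑ i ∈ A.filter (fun i : Fin 8 => (i : ℕ) < 4), c i • v i) ∧
        (∀ i ∈ A.filter (fun i : Fin 8 => (i : ℕ) < 4), 0 < c i → 0 < β i) := by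
  obtain ⟨hord12, hord23⟩ := le_of_mem_convexHull_v hx₀
  have habs (k : Fin 4) : |u₀ k| ≤ 1 := hu₀.2 ▸ norm_le_pi_norm u₀ k
  have hdist (k : Fin 4) := abs_lt.1 ((norm_le_pi_norm (u₀ - x₀) k).trans_lt hclose)
  simp only [Pi.sub_apply] at hdist
  have d1 := hdist 1
  have d2 := hdist 2
  have d3 := hdist 3
  obtain ⟨w, hw, hsum, hu, hlt⟩ := exists_weights hε0 hu₀.1 (fun k => (abs_le.1 (habs k)).1)
    (fun k => (abs_le.1 (habs k)).2) (by linarith) (by linarith) (by linarith)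
  set s := Finset.univ.filter (fun i : Fin 8 => (i : ℕ) < 4)
  have hcompl : ∑ i ∈ sᶜ, w i = w 4 + w 5 + w 6 + w 7 := by
    rw [show sᶜ = {4, 5, 6, 7} by decide]
    simp [add_assoc]
  have hs : 0 < ∑ i ∈ s, w i := by
    have := Finset.sum_add_sum_compl s w
    linarith
  have hc : ∀ i ∈ s, 0 ≤ w i / ∑ j ∈ s, w j := fun i _ => div_nonneg (hw i) hs.le
  have hc1 : ∑ i ∈ s, w i / ∑ j ∈ s, w j = 1 := by rw [← Finset.sum_div, div_self hs.ne']
  refine ⟨_, sum_smul_v_mem_E1 s _ hc hc1, ?_, Finset.univ, w, _, fun i _ => hw i, hsum, hu, hc, hc1,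
    rfl, fun i _ hi => (div_pos_iff_of_pos_right hs).1 hi⟩
  have hle := norm_renormalize_sub_le s w hw hsum hs
  rw [← hu] at hle
  linarith
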